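/- arXiv:2203.00134 — 10 statements merged into one kernel-verified Lean document; each statement's English description precedes it below -/
import Mathlib

section
/- For agents 1,…,n with positions p_i ∈ ℝ and capacities Δ_i > 0, and any integer k ≥ 1: for every finite set T ⊆ ℝ of target levels with |T| ≤ k, there exists a set T' ⊆ ⋃_{i=1}^n {p_i, p_i + Δ_i} with |T'| ≤ k such that SW(T') ≥ SW(T). In particular, the maximum social welfare over all finite target sets of size at most k is attained by a subset of the potential target set ⋃_{i=1}^n {p_i, p_i + Δ_i}. -/
/-- Improvement of an agent at position `p` with capacity `Δ` given target set `T`: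
the agent moves to the smallest target `τ ∈ T` with `p < τ ≤ p + Δ`, if any. -/
noncomputable def imp (Δ p : ℝ) (T : Finset ℝ) : ℝ :=
  if h : (T.filter (fun τ => p < τ ∧ τ ≤ p + Δ)).Nonempty then
    (T.filter (fun τ => p < τ ∧ τ ≤ p + Δ)).min' h - p
  else 0

/-- Social welfare in the individualized improvement capacity model. -/
noncomputable def sw (n : ℕ) (p Δ : Fin n → ℝ) (T : Finset ℝ) : ℝ :=
  ∑ i, imp (Δ i) (p i) T

theorem imp_nonneg_aux (Δ p : ℝ) (T : Finset ℝ) : 0 ≤ imp Δ p T := by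
  unfold imp
  split_ifs with h
  · have := Finset.min'_mem _ h
    rw [Finset.mem_filter] at this
    linarith [this.2.1]
  · exact le_rfl

/-- optimal target sets may be assumed to lie in the potential target set
`⋃ i {p i, p i + Δ i}`. -/
theorem optimal_targets_in_potential_set
    (n : ℕ) (p Δ : Fin n → ℝ) (hΔ : ∀ i, 0 < Δ i) (k : ℕ) (hk : 1 ≤ k)
    (T : Finset ℝ) (hT : T.card ≤ k) :
    ∃ T' : Finset ℝ,
      T' ⊆ (Finset.univ.image p ∪ Finset.univ.image (fun i => p i + Δ i)) ∧
      T'.card ≤ k ∧ sw n p Δ T ≤ sw n p Δ T' := by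
  classical
  set P := (Finset.univ.image p ∪ Finset.univ.image (fun i => p i + Δ i)) with hP
  have hp : ∀ i, p i ∈ P := fun i => by simp [hP]
  have hq : ∀ i, p i + Δ i ∈ P := fun i =>
    Finset.mem_union_right _ (Finset.mem_image_of_mem (fun i => p i + Δ i) (Finset.mem_univ i))
  have hr : ∀ τ : ℝ, ∃ q : ℝ, (∃ x ∈ P, τ ≤ x) → q ∈ P ∧ τ ≤ q ∧ ∀ x ∈ P, τ ≤ x → q ≤ x := by
    intro τ
    by_cases h : ∃ x ∈ P, τ ≤ x
    · have hne : (P.filter (fun x => τ ≤ x)).Nonempty := by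
        obtain ⟨x, hx, hx'⟩ := h
        exact ⟨x, Finset.mem_filter.2 ⟨hx, hx'⟩⟩
      refine ⟨(P.filter (fun x => τ ≤ x)).min' hne, fun _ => ?_⟩
      have hm := Finset.mem_filter.1 (Finset.min'_mem _ hne)
      exact ⟨hm.1, hm.2, fun x hx hx' => Finset.min'_le _ _ (Finset.mem_filter.2 ⟨hx, hx'⟩)⟩
    · exact ⟨0, fun h' => absurd h' h⟩
  choose r hr using hr
  refine ⟨(T.filter (fun τ => ∃ x ∈ P, τ ≤ x)).image r, ?_, ?_, ?_⟩
  · intro y hy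
    obtain ⟨τ, hτ, rfl⟩ := Finset.mem_image.1 hy
    exact (hr τ (Finset.mem_filter.1 hτ).2).1
  · exact Finset.card_image_le.trans ((Finset.card_filter_le _ _).trans hT)
  · unfold sw
    refine Finset.sum_le_sum fun i _ => ?_
    by_cases h : (T.filter (fun τ => p i < τ ∧ τ ≤ p i + Δ i)).Nonempty
    · have h' : (((T.filter (fun τ => ∃ x ∈ P, τ ≤ x)).image r).filter
          (fun τ => p i < τ ∧ τ ≤ p i + Δ i)).Nonempty := by
        obtain ⟨τ, hτ⟩ := h
        obtain ⟨h1, h2, h3⟩ := Finset.mem_filter.1 hτ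
        have he : ∃ x ∈ P, τ ≤ x := ⟨_, hq i, h3⟩
        obtain ⟨-, h5, h6⟩ := hr τ he
        exact ⟨r τ, Finset.mem_filter.2 ⟨Finset.mem_image_of_mem _ (Finset.mem_filter.2 ⟨h1, he⟩),
          h2.trans_le h5, h6 _ (hq i) h3⟩⟩
      unfold imp
      rw [dif_pos h, dif_pos h']
      refine sub_le_sub_right (Finset.le_min' _ _ _ fun y hy => ?_) _
      obtain ⟨h1, h2, h3⟩ := Finset.mem_filter.1 hy
      obtain ⟨τ, hτ, rfl⟩ := Finset.mem_image.1 h1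
      obtain ⟨h4, he⟩ := Finset.mem_filter.1 hτ
      obtain ⟨-, h5, h6⟩ := hr τ he
      have h7 : p i < τ := by
        by_contra hc
        exact absurd (h6 _ (hp i) (not_lt.1 hc)) (not_le.2 h2)
      exact (Finset.min'_le _ _ (Finset.mem_filter.2 ⟨h4, h7, h5.trans h3⟩)).trans h5
    · have : imp (Δ i) (p i) T = 0 := by unfold imp; rw [dif_neg h]
      rw [this]
      exact imp_nonneg_aux _ _ _
end

section
/- In the common improvement capacity model with capacity Δ > 0: let A be a finite multiset of agent positions and T ⊆ ℝ a finite set of target levels. If there exist a, b, c ∈ T with a < b < c and c < a + Δ, then removing b weakly increases social welfare: SW_A(T \ {b}) ≥ SW_A(T). -/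
/-- Social welfare of a finite multiset `A` of agent positions sharing common capacity `Δ`. -/
noncomputable def swM (Δ : ℝ) (A : Multiset ℝ) (T : Finset ℝ) : ℝ :=
  (A.map (fun p => imp Δ p T)).sum

/-- in the common capacity model, if `a < b < c` are targets with `c < a + Δ`,
removing the middle target `b` weakly increases social welfare. -/
theorem remove_middle_target_weakly_increases_welfare
    (Δ : ℝ) (hΔ : 0 < Δ) (A : Multiset ℝ) (T : Finset ℝ) (a b c : ℝ)
    (ha : a ∈ T) (hb : b ∈ T) (hc : c ∈ T)
    (hab : a < b) (hbc : b < c) (hca : c < a + Δ) :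
    swM Δ A T ≤ swM Δ A (T.erase b) := by
  unfold swM
  apply Multiset.sum_map_le_sum_map
  intro p _
  unfold imp
  by_cases h : (T.filter (fun τ => p < τ ∧ τ ≤ p + Δ)).Nonempty
  · have h' : ((T.erase b).filter (fun τ => p < τ ∧ τ ≤ p + Δ)).Nonempty := by
      have hm := Finset.min'_mem _ h
      have hle : ∀ x ∈ T.filter (fun τ => p < τ ∧ τ ≤ p + Δ),
          (T.filter (fun τ => p < τ ∧ τ ≤ p + Δ)).min' h ≤ x :=
        fun x hx => Finset.min'_le _ x hx
      generalize (T.filter (fun τ => p < τ ∧ τ ≤ p + Δ)).min' h = m at hm hle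
      simp only [Finset.mem_filter] at hm hle
      obtain ⟨hmT, hm1, hm2⟩ := hm
      by_cases hmb : m = b
      · subst hmb
        have hpa : a ≤ p := by
          by_contra hlt
          push Not at hlt
          have := hle a ⟨ha, hlt, by linarith⟩
          linarith
        exact ⟨c, Finset.mem_filter.2
          ⟨Finset.mem_erase.2 ⟨hbc.ne', hc⟩, by linarith, by linarith⟩⟩
      · exact ⟨m, Finset.mem_filter.2 ⟨Finset.mem_erase.2 ⟨hmb, hmT⟩, hm1, hm2⟩⟩
    rw [dif_pos h, dif_pos h']
    have := Finset.min'_subset h' (Finset.filter_subset_filter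
      (fun τ => p < τ ∧ τ ≤ p + Δ) (Finset.erase_subset b T))
    linarith
  · have h' : ¬ ((T.erase b).filter (fun τ => p < τ ∧ τ ≤ p + Δ)).Nonempty := fun h2 =>
      h (h2.mono (Finset.filter_subset_filter _ (Finset.erase_subset b T)))
    rw [dif_neg h, dif_neg h']
end

section
/- Increasing the allowed number of targets by a factor of g increases optimal welfare by at most a factor of g: for agents 1,…,n with positions p_i ∈ ℝ and capacities Δ_i > 0, any integers k ≥ 1 and g ≥ 1, and any finite target set T ⊆ ℝ with |T| ≤ k, there exists T' ⊆ T with |T'| ≤ ⌈k/g⌉ and SW(T') ≥ SW(T)/g. -/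
theorem imp_le_sum_aux (Δ p : ℝ) (T : Finset ℝ) (g : ℕ) (c : ℝ → ℕ) (hc : ∀ x, c x < g) :
    imp Δ p T ≤ ∑ j ∈ Finset.range g, imp Δ p (T.filter (fun x => c x = j)) := by
  by_cases h : (T.filter (fun τ => p < τ ∧ τ ≤ p + Δ)).Nonempty
  · set m := (T.filter (fun τ => p < τ ∧ τ ≤ p + Δ)).min' h with hm
    have hmem := Finset.mem_filter.1 (Finset.min'_mem _ h)
    rw [← hm] at hmem
    have key : imp Δ p T ≤ imp Δ p (T.filter (fun x => c x = c m)) := by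
      have h2 : ((T.filter (fun x => c x = c m)).filter
          (fun τ => p < τ ∧ τ ≤ p + Δ)).Nonempty :=
        ⟨m, by simp [hmem.1, hmem.2.1, hmem.2.2]⟩
      unfold imp
      rw [dif_pos h, dif_pos h2]
      exact sub_le_sub_right (Finset.min'_subset h2
        (Finset.filter_subset_filter _ (Finset.filter_subset _ _))) p
    exact key.trans (Finset.single_le_sum
      (f := fun j => imp Δ p (T.filter (fun x => c x = j)))
      (fun j _ => imp_nonneg_aux _ _ _) (Finset.mem_range.2 (hc m)))
  · have h0 : imp Δ p T = 0 := by unfold imp; rw [dif_neg h]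
    rw [h0]
    exact Finset.sum_nonneg fun j _ => imp_nonneg_aux _ _ _

/-- for any target set of size at most `k` there is a subset of size at most
`⌈k/g⌉` achieving at least a `1/g` fraction of its social welfare. -/
theorem exists_small_subset_good_welfare
    (n : ℕ) (p Δ : Fin n → ℝ) (hΔ : ∀ i, 0 < Δ i) (k g : ℕ) (hk : 1 ≤ k) (hg : 1 ≤ g)
    (T : Finset ℝ) (hT : T.card ≤ k) :
    ∃ T' : Finset ℝ, T' ⊆ T ∧ T'.card ≤ (k + g - 1) / g ∧
      sw n p Δ T / g ≤ sw n p Δ T' := by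
  classical
  have hf : ∃ f : ℝ → ℕ, (∀ x ∈ T, f x < k) ∧ Set.InjOn f T := by
    refine ⟨fun x => if h : x ∈ T then (T.equivFin ⟨x, h⟩ : ℕ) else 0, ?_, ?_⟩
    · intro x hx
      simp only [hx, dif_pos]
      exact (T.equivFin ⟨x, hx⟩).2.trans_le hT
    · intro x hx y hy hxy
      have hx' : x ∈ T := hx
      have hy' : y ∈ T := hy
      simp only [hx', hy', dif_pos] at hxy
      have := T.equivFin.injective (Fin.ext hxy)
      exact congrArg Subtype.val this
  obtain ⟨f, hfk, hinj⟩ := hf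
  have hcard : ∀ j, (T.filter (fun x => f x % g = j)).card ≤ (k + g - 1) / g := by
    intro j
    rw [← Finset.card_range ((k + g - 1) / g)]
    apply Finset.card_le_card_of_injOn (fun x => f x / g)
    · intro x hx
      have hx1 := hfk x (Finset.mem_filter.1 hx).1
      simp only [Finset.coe_range, Set.mem_Iio]
      have h1 : f x / g + 1 = (f x + g) / g := (Nat.add_div_right _ hg).symm
      have h2 : (f x + g) / g ≤ (k + g - 1) / g := Nat.div_le_div_right (by omega)
      omega
    · intro x hx y hy hxy
      have hx1 := Finset.mem_filter.1 hx
      have hy1 := Finset.mem_filter.1 hy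
      apply hinj hx1.1 hy1.1
      have hxy' : f x / g = f y / g := hxy
      rw [← Nat.div_add_mod (f x) g, ← Nat.div_add_mod (f y) g, hxy', hx1.2, hy1.2]
  have hsum : sw n p Δ T ≤
      ∑ j ∈ Finset.range g, sw n p Δ (T.filter (fun x => f x % g = j)) := by
    unfold sw
    rw [Finset.sum_comm]
    exact Finset.sum_le_sum fun i _ =>
      imp_le_sum_aux _ _ _ g (fun x => f x % g) (fun x => Nat.mod_lt _ hg)
  have hgpos : (0 : ℝ) < g := by exact_mod_cast hg
  obtain ⟨j, _, hj⟩ := Finset.exists_le_of_sum_le (s := Finset.range g)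
    (f := fun _ => sw n p Δ T / g)
    (g := fun j => sw n p Δ (T.filter (fun x => f x % g = j)))
    ⟨0, Finset.mem_range.2 hg⟩ (by
      rw [Finset.sum_const, Finset.card_range, nsmul_eq_mul, mul_div_cancel₀ _ hgpos.ne']
      exact hsum)
  exact ⟨_, Finset.filter_subset _ _, hcard j, hj⟩
end

section
/- (Location of an optimal single target.) In the common improvement capacity model with capacity Δ > 0: let τ ∈ ℝ and let A be a nonempty finite multiset of agent positions with A ⊆ [τ − Δ, τ). If τ' ∈ ℝ maximizes the single-target social welfare of A, i.e., SW_A({τ'}) ≥ SW_A({σ}) for every σ ∈ ℝ, then τ ≤ τ' ≤ τ + Δ. -/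
lemma imp_singleton_eq (Δ p σ : ℝ) :
    imp Δ p {σ} = if p < σ ∧ σ ≤ p + Δ then σ - p else 0 := by
  unfold imp
  by_cases h : p < σ ∧ σ ≤ p + Δ
  · simp [Finset.filter_singleton, h]
  · simp [Finset.filter_singleton, h]

/-- an optimal single target for a nonempty set of agents contained in
`[τ - Δ, τ)` lies in `[τ, τ + Δ]`. -/
theorem optimal_single_target_location
    (Δ τ : ℝ) (hΔ : 0 < Δ) (A : Multiset ℝ) (hA : A ≠ 0)
    (hloc : ∀ q ∈ A, τ - Δ ≤ q ∧ q < τ)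
    (τ' : ℝ) (hopt : ∀ σ : ℝ, swM Δ A {σ} ≤ swM Δ A {τ'}) :
    τ ≤ τ' ∧ τ' ≤ τ + Δ := by
  by_contra hcon
  refine absurd (hopt τ) (not_le.mpr ?_)
  unfold swM
  refine Multiset.sum_lt_sum_of_nonempty hA ?_
  intro q hq
  obtain ⟨h1, h2⟩ := hloc q hq
  rw [imp_singleton_eq, imp_singleton_eq, if_pos (c := q < τ ∧ τ ≤ q + Δ) ⟨h2, by linarith⟩]
  split_ifs with h
  · by_contra hle
    exact hcon ⟨by linarith, by linarith [h.2]⟩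
  · linarith
end

section
/- (Relocation lemma.) In the common improvement capacity model with capacity Δ > 0: let A be a nonempty finite multiset of agent positions with A ⊆ [τ − Δ, τ), and suppose τ maximizes the single-target social welfare of A, i.e., SW_A({τ}) ≥ SW_A({σ}) for every σ ∈ ℝ. Then for every x ∈ [0, 1] and every τ'' ∈ [τ − Δ + xΔ, τ], relocating the target to τ'' preserves a quadratic fraction of the optimum: SW_A({τ''}) ≥ (x²/6)·SW_A({τ}). -/
theorem imp_singleton (Δ p t : ℝ) :
    imp Δ p {t} = if p < t ∧ t ≤ p + Δ then t - p else 0 := by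
  unfold imp
  by_cases h : p < t ∧ t ≤ p + Δ
  · simp [Finset.filter_singleton, h]
  · simp [Finset.filter_singleton, h]

/-- relocation lemma: if `τ` is an optimal single target for a nonempty set
of agents contained in `[τ - Δ, τ)`, then relocating the target to any point of
`[τ - Δ + xΔ, τ]` retains an `x²/6` fraction of the optimal welfare. -/
theorem relocation_lemma
    (Δ τ : ℝ) (hΔ : 0 < Δ) (A : Multiset ℝ) (hA : A ≠ 0)
    (hloc : ∀ q ∈ A, τ - Δ ≤ q ∧ q < τ)
    (hopt : ∀ σ : ℝ, swM Δ A {σ} ≤ swM Δ A {τ})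
    (x : ℝ) (hx0 : 0 ≤ x) (hx1 : x ≤ 1)
    (τ'' : ℝ) (hτ''l : τ - Δ + x * Δ ≤ τ'') (hτ''r : τ'' ≤ τ) :
    (x ^ 2 / 6) * swM Δ A {τ} ≤ swM Δ A {τ''} := by
  have key : ∀ q ∈ A, x ^ 2 * imp Δ q {τ} + 2 * x * imp Δ q {τ}
      ≤ 6 * imp Δ q {τ''} + 2 * x * imp Δ q {τ + x * Δ / 2} := by
    intro q hq
    obtain ⟨h1, h2⟩ := hloc q hq
    have hxD : 0 ≤ x * Δ := by positivity
    have e1 : imp Δ q {τ} = τ - q := by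
      rw [imp_singleton, if_pos ⟨h2, by linarith⟩]
    have e2 : τ'' - q ≤ imp Δ q {τ''} ∧ 0 ≤ imp Δ q {τ''} := by
      rw [imp_singleton]
      split_ifs with h
      · exact ⟨le_rfl, by linarith [h.1]⟩
      · refine ⟨?_, le_rfl⟩
        by_contra hc
        exact h ⟨by linarith, by linarith⟩
    obtain ⟨e2, e3⟩ := e2
    rw [e1, imp_singleton Δ q (τ + x * Δ / 2)]
    split_ifs with h
    · nlinarith [mul_nonneg (sq_nonneg x) (by linarith : 0 ≤ q - (τ - Δ))]
    · have hc : q + Δ < τ + x * Δ / 2 := by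
        by_contra hc
        exact h ⟨by linarith, by linarith⟩
      have a0 : 0 ≤ q - (τ - Δ) := by linarith
      have b1 : x ^ 2 + 2 * x ≤ 3 * x := by nlinarith
      have b2 : (x ^ 2 + 2 * x) * (τ - q) ≤ 3 * x * (τ - q) :=
        mul_le_mul_of_nonneg_right b1 (by linarith)
      have b3 : x * (τ - q) ≤ x * Δ := mul_le_mul_of_nonneg_left (by linarith) hx0
      nlinarith
  have hs := Multiset.sum_map_le_sum_map _ _ key
  simp only [Multiset.sum_map_add, Multiset.sum_map_mul_left] at hs
  have ho := hopt (τ + x * Δ / 2)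
  unfold swM at ho ⊢
  have := mul_le_mul_of_nonneg_left ho (by linarith : 0 ≤ 2 * x)
  linarith
end

section
/- (Resolving interference of targets.) Let Δ > 0 and g ≥ 1, and let T = T_1 ∪ ⋯ ∪ T_g ⊆ ℝ be a finite union of sets such that within each T_ℓ any two distinct elements are at distance at least Δ. Then there exists a finite set T* ⊆ ℝ with |T*| ≤ |T| such that for every τ ∈ T: (i) T* contains a point in the interval [τ − Δ + Δ/g, τ], and (ii) T* contains no point in the open interval (τ − Δ, τ − Δ + Δ/g). -/
/-- resolving interference of targets: given `g` sets of targets, each with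
pairwise distances at least `Δ`, there is a set `T*` of at most as many targets such that
for every original target `τ`, `T*` meets `[τ - Δ + Δ/g, τ]` and avoids
`(τ - Δ, τ - Δ + Δ/g)`. -/
theorem resolve_interference
    (Δ : ℝ) (hΔ : 0 < Δ) (g : ℕ) (hg : 1 ≤ g) (T : Fin g → Finset ℝ)
    (hsep : ∀ ℓ : Fin g, ∀ x ∈ T ℓ, ∀ y ∈ T ℓ, x ≠ y → Δ ≤ |x - y|) :
    ∃ Tstar : Finset ℝ,
      Tstar.card ≤ (Finset.univ.biUnion T).card ∧
      ∀ τ ∈ Finset.univ.biUnion T,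
        (∃ σ ∈ Tstar, τ - Δ + Δ / g ≤ σ ∧ σ ≤ τ) ∧
        (∀ σ ∈ Tstar, ¬(τ - Δ < σ ∧ σ < τ - Δ + Δ / g)) := by
  classical
  have hg' : (1:ℝ) ≤ g := by exact_mod_cast hg
  have hg0 : (g:ℝ) ≠ 0 := by linarith
  obtain ⟨ε, hε⟩ : ∃ ε, ε = Δ / (g:ℝ) := ⟨_, rfl⟩
  have hεpos : 0 < ε := by rw [hε]; positivity
  have hgε : (g:ℝ) * ε = Δ := by rw [hε]; field_simp
  rw [← hε]
  have key : ∀ τ ∈ Finset.univ.biUnion T, ∃ σ : ℝ, (τ - Δ + ε ≤ σ ∧ σ ≤ τ) ∧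
      ∀ t ∈ Finset.univ.biUnion T, ¬(t - Δ < σ ∧ σ < t - Δ + ε) := by
    intro τ hτ
    obtain ⟨l0, -, hl0⟩ := Finset.mem_biUnion.1 hτ
    have hW : ∀ k : Fin g, τ - Δ + ε ≤ τ - (k:ℕ) * ε ∧ τ - (k:ℕ) * ε ≤ τ := by
      intro k
      have h1 : ((k:ℕ):ℝ) + 1 ≤ g := by exact_mod_cast k.2
      have h0 : (0:ℝ) ≤ (k:ℕ) := Nat.cast_nonneg _
      constructor
      · nlinarith
      · nlinarith
    by_contra hcon
    push Not at hcon
    have hc : ∀ k : Fin g, ∃ l : Fin g, ∃ t ∈ T l,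
        t - Δ < τ - (k:ℕ) * ε ∧ τ - (k:ℕ) * ε < t - Δ + ε := by
      intro k
      obtain ⟨t, ht, h⟩ := hcon _ (hW k)
      obtain ⟨l, -, hl⟩ := Finset.mem_biUnion.1 ht
      exact ⟨l, t, hl, h⟩
    choose f t ht h1 h2 using hc
    have hinj : Function.Injective f := by
      intro a b hab
      have heq : t a = t b := by
        by_contra hne
        have hb := ht b
        rw [← hab] at hb
        have := hsep _ _ (ht a) _ hb hne
        have hlt : |t a - t b| < Δ := by
          rw [abs_lt]
          constructor <;>
            linarith [(hW a).1, (hW a).2, (hW b).1, (hW b).2, h1 a, h2 a, h1 b, h2 b]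
        linarith
      have ha1 := h1 a
      have ha2 := h2 a
      rw [heq] at ha1 ha2
      have hx : ((a:ℕ):ℝ) < (b:ℕ) + 1 := by
        have : ((a:ℕ):ℝ) * ε < ((b:ℕ) + 1) * ε := by linarith [h1 b, h2 b]
        exact lt_of_mul_lt_mul_right this hεpos.le
      have hy : ((b:ℕ):ℝ) < (a:ℕ) + 1 := by
        have : ((b:ℕ):ℝ) * ε < ((a:ℕ) + 1) * ε := by linarith [h1 b, h2 b]
        exact lt_of_mul_lt_mul_right this hεpos.le
      have hx' : (a:ℕ) < (b:ℕ) + 1 := by exact_mod_cast hx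
      have hy' : (b:ℕ) < (a:ℕ) + 1 := by exact_mod_cast hy
      apply Fin.ext
      omega
    obtain ⟨k, hk⟩ := (Finite.injective_iff_surjective.1 hinj) l0
    have htk := ht k
    rw [hk] at htk
    have hgt : τ < t k := by linarith [(hW k).1, h2 k]
    have hs := hsep l0 _ htk _ hl0 hgt.ne'
    rw [abs_of_pos (by linarith)] at hs
    linarith [(hW k).2, h1 k]
  choose! s hs1 hs2 using key
  refine ⟨(Finset.univ.biUnion T).image s, Finset.card_image_le, ?_⟩
  intro τ hτ
  refine ⟨⟨s τ, Finset.mem_image_of_mem _ hτ, hs1 τ hτ⟩, ?_⟩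
  intro σ hσ
  obtain ⟨t, ht, rfl⟩ := Finset.mem_image.1 hσ
  exact hs2 t ht τ hτ
end

section
/- (Simultaneous approximate optimality, main structural result.) There exists a universal constant c > 0 such that the following holds in the common improvement capacity model with capacity Δ > 0. Let the agents be partitioned into groups G_1,…,G_g (each a finite multiset of positions in ℝ) and let k ≥ g be an integer. Then there exists a finite target set T ⊆ ℝ with |T| ≤ k such that for every group ℓ ∈ {1,…,g}: SW_ℓ(T) ≥ (c/g³)·OPT_ℓ^{k}, where OPT_ℓ^{k} is the maximum of SW_ℓ(T') over all finite T' ⊆ ℝ with |T'| ≤ k. -/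
/-- Number (as a real) of agents of `A` whose label `s p` is `j`. -/
noncomputable def cntM (A : Multiset ℝ) (s : ℝ → ℤ) (j : ℤ) : ℝ :=
  (A.map (fun p => if s p = j then (1 : ℝ) else 0)).sum

lemma cntM_nonneg (A : Multiset ℝ) (s : ℝ → ℤ) (j : ℤ) : 0 ≤ cntM A s j := by
  apply Multiset.sum_nonneg
  intro x hx
  obtain ⟨p, _, rfl⟩ := Multiset.mem_map.1 hx
  split_ifs <;> norm_num

lemma sum_cntM (A : Multiset ℝ) (s : ℝ → ℤ) (J : Finset ℤ) :
    ∑ j ∈ J, cntM A s j = (A.map (fun p => if s p ∈ J then (1 : ℝ) else 0)).sum := by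
  unfold cntM
  rw [← Multiset.sum_map_sum]
  congr 1
  apply Multiset.map_congr rfl
  intro p _
  simp

lemma cntM_eq_zero (A : Multiset ℝ) (s : ℝ → ℤ) (j : ℤ) (h : j ∉ (A.map s).toFinset) :
    cntM A s j = 0 := by
  apply Multiset.sum_eq_zero
  intro x hx
  obtain ⟨p, hp, rfl⟩ := Multiset.mem_map.1 hx
  rw [if_neg]
  rintro rfl
  exact h (Multiset.mem_toFinset.2 (Multiset.mem_map_of_mem s hp))

lemma exists_top (w : ℤ → ℝ) (S : Finset ℤ) (hS : ∀ j, j ∉ S → w j = 0) (q : ℕ) :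
    ∃ B : Finset ℤ, B.card ≤ q ∧ ∀ r : ℕ, ∀ B' : Finset ℤ, B'.card ≤ r * q →
      ∑ j ∈ B', w j ≤ r * ∑ j ∈ B, w j := by
  obtain ⟨B, hB, hmax⟩ := (S.powerset.filter (fun B => B.card ≤ q)).exists_max_image
    (fun B => ∑ j ∈ B, w j) ⟨∅, by simp⟩
  simp only [Finset.mem_filter, Finset.mem_powerset] at hB hmax
  have h1 : ∀ B' : Finset ℤ, B'.card ≤ q → ∑ j ∈ B', w j ≤ ∑ j ∈ B, w j := by
    intro B' hB'
    have := hmax (B' ∩ S) ⟨Finset.inter_subset_right,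
      (Finset.card_le_card Finset.inter_subset_left).trans hB'⟩
    rw [← Finset.sum_subset (Finset.inter_subset_left (s₁ := B') (s₂ := S))]
    · exact this
    · intro x hx hx'
      apply hS
      intro h
      exact hx' (Finset.mem_inter.2 ⟨hx, h⟩)
  refine ⟨B, hB.2, ?_⟩
  intro r
  induction r with
  | zero =>
    intro B' h
    have : B' = ∅ := by simpa using h
    simp [this]
  | succ r ih =>
    intro B' h
    obtain ⟨C, hC, hCc⟩ := Finset.exists_subset_card_eq (Nat.min_le_left B'.card q)
    have e1 := h1 C (by omega)
    have e2 := ih (B' \ C) (by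
      rw [Finset.card_sdiff_of_subset hC, hCc]
      rw [add_mul] at h
      omega)
    rw [← Finset.sum_sdiff hC]
    push_cast
    linarith

lemma group_lemma (Δ : ℝ) (hΔ : 0 < Δ) (m : ℕ) (hm : 1 ≤ m) (q r k : ℕ) (hk : 2 * k ≤ r * q)
    (A : Multiset ℝ) :
    ∃ J : Finset ℤ, J.card ≤ q ∧ (∀ i ∈ J, ∀ j ∈ J, i / (m : ℤ) = j / (m : ℤ) → i = j) ∧
      ∀ T' : Finset ℝ, T'.card ≤ k →
        swM Δ A T' ≤ Δ * (r * (m * ∑ j ∈ J, cntM A (fun p => ⌊p / (Δ / m)⌋) j)) := by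
  have hmR : (0 : ℝ) < m := by exact_mod_cast hm
  have hmZ : (0 : ℤ) < m := by exact_mod_cast hm
  have hδ : 0 < Δ / m := by positivity
  set s : ℝ → ℤ := fun p => ⌊p / (Δ / m)⌋ with hs
  set b : ℝ → ℤ := fun p => s p / (m : ℤ) with hb
  have hshift : ∀ p, s (p + Δ) = s p + m := by
    intro p
    have : (p + Δ) / (Δ / m) = p / (Δ / m) + (m : ℕ) := by
      field_simp
    simp only [hs]
    rw [this, Int.floor_add_natCast]
  have hmono : ∀ p p', p ≤ p' → b p ≤ b p' := by
    intro p p' h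
    apply Int.ediv_le_ediv hmZ
    apply Int.floor_le_floor
    gcongr
  have hbshift : ∀ p, b (p + Δ) = b p + 1 := by
    intro p
    simp only [hb, hshift]
    rw [Int.add_ediv_of_dvd_right dvd_rfl, Int.ediv_self hmZ.ne']
  obtain ⟨B, hBc, hB⟩ := exists_top (cntM A b) (A.map b).toFinset (cntM_eq_zero A b) q
  -- best small cell in each big cell
  have hbest : ∀ β : ℤ, ∃ j : ℤ, j / (m : ℤ) = β ∧ cntM A b β ≤ m * cntM A s j := by
    intro β
    have hmem : ∀ i : ℤ, i ∈ Finset.Ico (m * β) (m * β + m) ↔ i / (m : ℤ) = β := by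
      intro i
      rw [Finset.mem_Ico, Int.ediv_eq_iff_of_pos hmZ]
      constructor <;> rintro ⟨h1, h2⟩ <;> constructor <;> linarith
    have hsum : cntM A b β = ∑ j ∈ Finset.Ico ((m : ℤ) * β) (m * β + m), cntM A s j := by
      rw [sum_cntM]
      simp only [hmem]
      rfl
    by_contra! hcon
    have hne : (Finset.Ico ((m : ℤ) * β) (m * β + m)).Nonempty := by
      rw [Finset.nonempty_Ico]; linarith
    have := Finset.sum_lt_sum_of_nonempty hne
      (fun j hj => hcon j ((hmem j).1 hj))
    rw [← Finset.mul_sum, ← hsum] at this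
    simp at this
  choose f hf1 hf2 using hbest
  refine ⟨B.image f, Finset.card_image_le.trans hBc, ?_, ?_⟩
  · intro i hi j hj hij
    obtain ⟨x, _, rfl⟩ := Finset.mem_image.1 hi
    obtain ⟨y, _, rfl⟩ := Finset.mem_image.1 hj
    rw [hf1, hf1] at hij
    rw [hij]
  · intro T' hT'
    set B' : Finset ℤ := T'.image b ∪ T'.image (fun τ => b τ - 1) with hB'
    have hcard : B'.card ≤ r * q := by
      have h1 := Finset.card_union_le (T'.image b) (T'.image (fun τ => b τ - 1))
      have h2 : (T'.image b).card ≤ T'.card := Finset.card_image_le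
      have h3 : (T'.image (fun τ => b τ - 1)).card ≤ T'.card := Finset.card_image_le
      rw [← hB'] at h1
      omega
    have h1 : swM Δ A T' ≤ Δ * ∑ β ∈ B', cntM A b β := by
      rw [sum_cntM, ← Multiset.sum_map_mul_left]
      apply Multiset.sum_map_le_sum_map
      intro p _
      unfold imp
      split_ifs with h hp hp
      · have := Finset.min'_mem _ h
        rw [Finset.mem_filter] at this
        linarith [this.2.2]
      · exfalso
        obtain ⟨τ, hτ⟩ := h
        rw [Finset.mem_filter] at hτ
        obtain ⟨hτT, h1, h2⟩ := hτ
        apply hp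
        have e1 := hmono _ _ h1.le
        have e2 := hmono _ _ h2
        rw [hbshift] at e2
        rw [hB', Finset.mem_union, Finset.mem_image, Finset.mem_image]
        rcases (by omega : b τ = b p ∨ b τ - 1 = b p) with h | h
        · exact Or.inl ⟨τ, hτT, h⟩
        · exact Or.inr ⟨τ, hτT, h⟩
      · linarith
      · simp
    have h2 := hB r B' hcard
    have h3 : ∑ j ∈ B, cntM A b j ≤ m * ∑ j ∈ B.image f, cntM A s j := by
      rw [Finset.sum_image, Finset.mul_sum]
      · exact Finset.sum_le_sum (fun j _ => hf2 j)
      · intro x _ y _ hxy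
        have := congrArg (· / (m : ℤ)) hxy
        simpa [hf1] using this
    refine h1.trans (mul_le_mul_of_nonneg_left (h2.trans ?_) hΔ.le)
    exact mul_le_mul_of_nonneg_left h3 (Nat.cast_nonneg r)

/-- main structural result: simultaneous `Ω(1/g³)`-approximate optimality
for each group against the `k`-target benchmark, in the common improvement capacity
model. -/
theorem simultaneous_approximate_optimality :
    ∃ c : ℝ, 0 < c ∧
      ∀ (Δ : ℝ), 0 < Δ →
      ∀ (g : ℕ), 1 ≤ g →
      ∀ (G : Fin g → Multiset ℝ),
      ∀ (k : ℕ), g ≤ k →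
        ∃ T : Finset ℝ, T.card ≤ k ∧
          ∀ ℓ : Fin g, ∀ T' : Finset ℝ, T'.card ≤ k →
            (c / (g : ℝ) ^ 3) * swM Δ (G ℓ) T' ≤ swM Δ (G ℓ) T := by
  
  refine ⟨1 / 64, by norm_num, ?_⟩
  intro Δ hΔ g hg G k hgk
  set m : ℕ := 4 * g with hm
  set q : ℕ := k / g with hq
  have hq1 : g * q ≤ k := Nat.mul_div_le k g
  have hq2 : 2 * k ≤ (4 * g) * q := by
    have h1 : k < g * q + g := by
      have := Nat.div_add_mod k g
      have h2 := Nat.mod_lt k (show 0 < g by omega)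
      rw [← hq] at this
      omega
    have h3 : 1 ≤ q := (Nat.one_le_div_iff (by omega)).2 hgk
    nlinarith
  have hmR : (0 : ℝ) < m := by
    have : 0 < m := by omega
    exact_mod_cast this
  have hmZ : (0 : ℤ) < m := by omega
  choose J hJc hJinj hJ using fun ℓ : Fin g =>
    group_lemma Δ hΔ m (by omega) q (4 * g) k hq2 (G ℓ)
  set δ : ℝ := Δ / m with hδdef
  have hδ : 0 < δ := by positivity
  have hmδ : m * δ = Δ := by rw [hδdef]; field_simp
  set U : Finset ℤ := Finset.univ.biUnion J with hU
  have hUc : U.card ≤ k := by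
    refine (Finset.card_biUnion_le).trans ?_
    refine (Finset.sum_le_sum (fun ℓ _ => hJc ℓ)).trans ?_
    simpa using hq1
  have hex : ∀ j : ℤ, ∃ t : ℤ, j + 2 ≤ t ∧ t ≤ j + m ∧ t - 1 ∉ U := by
    intro j
    by_contra! hcon
    have hsub : Finset.Icc (j + 1) (j + m - 1) ⊆
        Finset.univ.biUnion (fun ℓ => (J ℓ).filter (fun i => j + 1 ≤ i ∧ i ≤ j + m - 1)) := by
      intro i hi
      rw [Finset.mem_Icc] at hi
      have := hcon (i + 1) (by omega) (by omega)
      rw [add_sub_cancel_right, hU, Finset.mem_biUnion] at this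
      obtain ⟨ℓ, hℓ, h⟩ := this
      exact Finset.mem_biUnion.2 ⟨ℓ, hℓ, Finset.mem_filter.2 ⟨h, hi⟩⟩
    have hc := (Finset.card_le_card hsub).trans Finset.card_biUnion_le
    have h2 : ∀ ℓ ∈ (Finset.univ : Finset (Fin g)),
        ((J ℓ).filter (fun i => j + 1 ≤ i ∧ i ≤ j + m - 1)).card ≤ 2 := by
      intro ℓ _
      have hle : ((J ℓ).filter (fun i => j + 1 ≤ i ∧ i ≤ j + m - 1)).card ≤
          ({j / (m : ℤ), j / (m : ℤ) + 1} : Finset ℤ).card := by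
        apply Finset.card_le_card_of_injOn (fun i => i / (m : ℤ))
        · intro i hi
          simp only [Finset.coe_filter, Set.mem_ofPred_eq] at hi
          have e1 : j / (m : ℤ) ≤ i / (m : ℤ) := Int.ediv_le_ediv hmZ (by omega)
          have e2 : i / (m : ℤ) ≤ (j + m) / (m : ℤ) := Int.ediv_le_ediv hmZ (by omega)
          rw [Int.add_ediv_of_dvd_right dvd_rfl, Int.ediv_self hmZ.ne'] at e2
          simp only [Finset.coe_insert, Finset.coe_singleton, Set.mem_insert_iff,
            Set.mem_singleton_iff]
          omega
        · intro x hx y hy hxy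
          simp only [Finset.coe_filter, Set.mem_ofPred_eq] at hx hy
          exact hJinj ℓ x hx.1 y hy.1 hxy
      exact hle.trans Finset.card_le_two
    have hc2 := hc.trans (Finset.sum_le_sum h2)
    simp only [Int.card_Icc, Finset.sum_const, Finset.card_univ, Fintype.card_fin,
      smul_eq_mul] at hc2
    omega
  choose t ht1 ht2 ht3 using hex
  refine ⟨U.image (fun j => (t j : ℝ) * δ), Finset.card_image_le.trans hUc, ?_⟩
  intro ℓ T' hT'
  have hup := hJ ℓ T' hT'
  set s : ℝ → ℤ := fun p => ⌊p / δ⌋ with hs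
  have hlow : δ * ∑ j ∈ J ℓ, cntM (G ℓ) s j ≤
      swM Δ (G ℓ) (U.image (fun j => (t j : ℝ) * δ)) := by
    rw [sum_cntM, ← Multiset.sum_map_mul_left]
    apply Multiset.sum_map_le_sum_map
    intro p _
    have himp : 0 ≤ imp Δ p (U.image (fun j => (t j : ℝ) * δ)) := by
      unfold imp
      split_ifs with h
      · have := Finset.min'_mem _ h
        rw [Finset.mem_filter] at this
        linarith [this.2.1]
      · exact le_rfl
    split_ifs with hp
    · have hpU : s p ∈ U := Finset.mem_biUnion.2 ⟨ℓ, Finset.mem_univ _, hp⟩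
      have hl : (s p : ℝ) * δ ≤ p := by
        have := Int.floor_le (p / δ)
        rwa [le_div_iff₀ hδ] at this
      have hr : p < ((s p : ℝ) + 1) * δ := by
        have := Int.lt_floor_add_one (p / δ)
        rwa [div_lt_iff₀ hδ] at this
      have hne : ((U.image (fun j => (t j : ℝ) * δ)).filter
          (fun τ => p < τ ∧ τ ≤ p + Δ)).Nonempty := by
        refine ⟨(t (s p) : ℝ) * δ, Finset.mem_filter.2 ⟨Finset.mem_image_of_mem _ hpU, ?_, ?_⟩⟩
        · have h : ((s p : ℝ) + 2) ≤ t (s p) := by exact_mod_cast ht1 (s p)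
          nlinarith
        · have h : (t (s p) : ℝ) ≤ (s p : ℝ) + m := by exact_mod_cast ht2 (s p)
          nlinarith
      unfold imp
      rw [dif_pos hne]
      have hmin := Finset.min'_mem _ hne
      rw [Finset.mem_filter] at hmin
      obtain ⟨hmin1, hmin2, _⟩ := hmin
      obtain ⟨i, _, hi⟩ := Finset.mem_image.1 hmin1
      rw [← hi] at hmin2 ⊢
      have e1 : (s p : ℝ) < t i := by
        by_contra! hh
        nlinarith
      have e2 : s p < t i := by exact_mod_cast e1
      have e3 : t i - 1 ≠ s p := by
        intro h
        exact ht3 i (h ▸ hpU)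
      have e4 : (s p : ℝ) + 2 ≤ t i := by
        have : s p + 2 ≤ t i := by omega
        exact_mod_cast this
      nlinarith
    · simpa using himp
  refine le_trans ?_ hlow
  have hgR : (0 : ℝ) < g := by exact_mod_cast hg
  have hpos : 0 ≤ (1 / 64 : ℝ) / (g : ℝ) ^ 3 := by positivity
  refine (mul_le_mul_of_nonneg_left hup hpos).trans (le_of_eq ?_)
  have hmg : (m : ℝ) = 4 * g := by rw [hm]; push_cast; ring
  rw [← hmδ, hmg]
  push_cast
  field_simp
  ring
end

section
/- (Upper bound of 1/g on simultaneous approximation.) Let g ≥ 1, let the common improvement capacity be Δ = 1, and for each ℓ ∈ {1,…,g} let group ℓ consist of a single agent at position (ℓ−1)/g. Then for every finite set T ⊆ ℝ of target levels, min_{1 ≤ ℓ ≤ g} I_{(ℓ−1)/g}(T) ≤ 1/g; that is, no placement of target levels (of any size) gives every group improvement strictly greater than 1/g, even though each group in isolation can achieve improvement 1 with a single target. -/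
/-- with `g` groups consisting of single agents at `0, 1/g, …, (g-1)/g` and
common capacity `Δ = 1`, every finite target set leaves some group with improvement at
most `1/g`. -/
theorem upper_bound_one_over_g
    (g : ℕ) (hg : 1 ≤ g) (T : Finset ℝ) :
    ∃ ℓ : Fin g, imp 1 ((ℓ : ℝ) / g) T ≤ 1 / g := by
  have hg0 : (0 : ℝ) < g := by exact_mod_cast hg
  by_cases h0 : (T.filter (fun τ => (0 : ℝ) < τ ∧ τ ≤ 0 + 1)).Nonempty
  · obtain ⟨τ, hτ⟩ := h0
    rw [Finset.mem_filter] at hτ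
    obtain ⟨hT, hpos, hle⟩ := hτ
    have hk1 : 0 < ⌈τ * g⌉₊ := Nat.ceil_pos.mpr (by positivity)
    have hk2 : ⌈τ * g⌉₊ ≤ g := Nat.ceil_le.mpr (by nlinarith)
    have hk3 : τ * g ≤ (⌈τ * g⌉₊ : ℝ) := Nat.le_ceil _
    have hk4 : (⌈τ * g⌉₊ : ℝ) < τ * g + 1 := Nat.ceil_lt_add_one (by positivity)
    obtain ⟨k, hk⟩ : ∃ k, ⌈τ * g⌉₊ = k + 1 := ⟨⌈τ * g⌉₊ - 1, by omega⟩
    rw [hk] at hk2 hk3 hk4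
    push_cast at hk3 hk4
    refine ⟨⟨k, by omega⟩, ?_⟩
    have h1 : (k : ℝ) / g < τ := by
      rw [div_lt_iff₀ hg0]; linarith
    have h2 : τ ≤ (k : ℝ) / g + 1 / g := by
      rw [← add_div, le_div_iff₀ hg0]; exact hk3
    have h3 : (0 : ℝ) ≤ (k : ℝ) / g := by positivity
    have hmem : τ ∈ T.filter (fun τ => (k : ℝ) / g < τ ∧ τ ≤ (k : ℝ) / g + 1) := by
      rw [Finset.mem_filter]
      exact ⟨hT, h1, by linarith⟩
    unfold imp
    rw [dif_pos ⟨τ, hmem⟩]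
    have h4 := Finset.min'_le _ τ hmem
    simp only at h4 ⊢
    linarith
  · refine ⟨⟨0, hg⟩, ?_⟩
    have hz : (((0 : ℕ) : ℝ) / g) = 0 := by simp
    simp only [hz]
    unfold imp
    rw [dif_neg h0]
    positivity
end

section
/- (Interference of group-optimal targets.) Let n ≥ 1, 0 < ε < 1, and common improvement capacity Δ = 1. Let group A consist of agents at positions 1, 3, 5, …, 2n−1 and group B of agents at positions 2−ε, 4−ε, …, 2n−ε. Then T_A = {2, 4, …, 2n} satisfies SW_A(T_A) = n, which is the maximum of SW_A over all finite target sets; T_B = {3−ε, 5−ε, …, 2n+1−ε} satisfies SW_B(T_B) = n, which is the maximum of SW_B over all finite target sets; yet under the union, SW_B(T_A ∪ T_B) = nε. -/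
theorem imp_eq_of_least {p τ : ℝ} {T : Finset ℝ} (hT : τ ∈ T) (h1 : p < τ) (h2 : τ ≤ p + 1)
    (hm : ∀ σ ∈ T, p < σ → τ ≤ σ) : imp 1 p T = τ - p := by
  have hmem : τ ∈ T.filter (fun τ => p < τ ∧ τ ≤ p + 1) := by simp [hT, h1, h2]
  unfold imp
  rw [dif_pos ⟨τ, hmem⟩]
  congr 1
  apply le_antisymm
  · exact Finset.min'_le _ _ hmem
  · apply Finset.le_min'
    intro σ hσ
    rw [Finset.mem_filter] at hσ
    exact hm σ hσ.1 hσ.2.1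

theorem imp_le_one (p : ℝ) (T : Finset ℝ) : imp 1 p T ≤ 1 := by
  unfold imp
  split_ifs with h
  · have := (Finset.mem_filter.1 (Finset.min'_mem _ h)).2.2
    linarith
  · norm_num

theorem swM_range (n : ℕ) (f : ℕ → ℝ) (T : Finset ℝ) :
    swM 1 ((Multiset.range n).map f) T = ∑ i ∈ Finset.range n, imp 1 (f i) T := by
  simp only [swM, Multiset.map_map]
  rfl

theorem swM_range_le (n : ℕ) (f : ℕ → ℝ) (T : Finset ℝ) :
    swM 1 ((Multiset.range n).map f) T ≤ n := by
  rw [swM_range]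
  calc _ ≤ ∑ i ∈ Finset.range n, (1 : ℝ) := Finset.sum_le_sum fun i _ => imp_le_one _ _
    _ = n := by simp

theorem swM_range_eq (n : ℕ) (f : ℕ → ℝ) (T : Finset ℝ) (c : ℝ)
    (h : ∀ i < n, imp 1 (f i) T = c) :
    swM 1 ((Multiset.range n).map f) T = n * c := by
  rw [swM_range, Finset.sum_congr rfl fun i hi => h i (Finset.mem_range.1 hi)]
  simp

theorem cast_le_of_lt_add_one {i j : ℕ} (h : (i : ℝ) < j + 1) : (i : ℝ) ≤ j := by
  have h' : i < j + 1 := by exact_mod_cast h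
  exact_mod_cast Nat.lt_succ_iff.1 h'

/-- interference of group-optimal targets: with `Δ = 1`, group `A` at
positions `1, 3, …, 2n-1` and group `B` at positions `2-ε, 4-ε, …, 2n-ε`, the sets
`T_A = {2, 4, …, 2n}` and `T_B = {3-ε, 5-ε, …, 2n+1-ε}` are each optimal for their own
group (achieving welfare `n`), yet under the union group `B` improves only by `nε`. -/
theorem interference_of_group_optimal_targets
    (n : ℕ) (hn : 1 ≤ n) (ε : ℝ) (hε0 : 0 < ε) (hε1 : ε < 1) :
    let A : Multiset ℝ := (Multiset.range n).map (fun i => 2 * (i : ℝ) + 1)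
    let B : Multiset ℝ := (Multiset.range n).map (fun i => 2 * ((i : ℝ) + 1) - ε)
    let TA : Finset ℝ := (Finset.range n).image (fun i : ℕ => 2 * ((i : ℝ) + 1))
    let TB : Finset ℝ := (Finset.range n).image (fun i : ℕ => 2 * ((i : ℝ) + 1) + 1 - ε)
    swM 1 A TA = n ∧ (∀ T : Finset ℝ, swM 1 A T ≤ n) ∧
    swM 1 B TB = n ∧ (∀ T : Finset ℝ, swM 1 B T ≤ n) ∧
    swM 1 B (TA ∪ TB) = n * ε := by
  intro A B TA TB
  have hA : A = (Multiset.range n).map (fun i : ℕ => 2 * (i : ℝ) + 1) := by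
    simp [A, Multiset.bind_def, Multiset.pure_def, Multiset.bind_singleton, Multiset.map_map]
  have hB : B = (Multiset.range n).map (fun i : ℕ => 2 * ((i : ℝ) + 1) - ε) := by
    simp [B, Multiset.bind_def, Multiset.pure_def, Multiset.bind_singleton, Multiset.map_map]
  rw [hA, hB]
  refine ⟨?_, fun T => swM_range_le n (fun i : ℕ => 2 * (i : ℝ) + 1) T, ?_,
    fun T => swM_range_le n (fun i : ℕ => 2 * ((i : ℝ) + 1) - ε) T, ?_⟩
  · rw [← mul_one (n : ℝ)]
    refine swM_range_eq n _ _ _ fun i hi => ?_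
    rw [imp_eq_of_least (τ := 2 * ((i : ℝ) + 1))
      (Finset.mem_image.2 ⟨i, Finset.mem_range.2 hi, rfl⟩) (by linarith) (by linarith)]
    · ring
    · intro σ hσ hp
      obtain ⟨j, -, rfl⟩ := Finset.mem_image.1 hσ
      have := cast_le_of_lt_add_one (i := i) (j := j) (by linarith)
      linarith
  · rw [← mul_one (n : ℝ)]
    refine swM_range_eq n _ _ _ fun i hi => ?_
    rw [imp_eq_of_least (τ := 2 * ((i : ℝ) + 1) + 1 - ε)
      (Finset.mem_image.2 ⟨i, Finset.mem_range.2 hi, rfl⟩) (by linarith) (by linarith)]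
    · ring
    · intro σ hσ hp
      obtain ⟨j, -, rfl⟩ := Finset.mem_image.1 hσ
      have := cast_le_of_lt_add_one (i := i) (j := j) (by linarith)
      linarith
  · refine swM_range_eq n _ _ _ fun i hi => ?_
    rw [imp_eq_of_least (τ := 2 * ((i : ℝ) + 1))
      (Finset.mem_union_left _ (Finset.mem_image.2 ⟨i, Finset.mem_range.2 hi, rfl⟩))
      (by linarith) (by linarith)]
    · ring
    · intro σ hσ hp
      rcases Finset.mem_union.1 hσ with hσ | hσ
      · obtain ⟨j, -, rfl⟩ := Finset.mem_image.1 hσ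
        have := cast_le_of_lt_add_one (i := i) (j := j) (by linarith)
        linarith
      · obtain ⟨j, -, rfl⟩ := Finset.mem_image.1 hσ
        have := cast_le_of_lt_add_one (i := i) (j := j) (by linarith)
        linarith
end

section
/- (Consecutive targets can be arbitrarily close in an optimal solution.) Let m ≥ 1 and common improvement capacity Δ = 1, and consider the agents consisting of one agent at position 0, one agent at position 1, and m agents at position 1 + 1/m. Then the target set T* = {1, 1 + 1/m, 2 + 1/m} satisfies SW(T*) = m + 1 + 1/m, and for every finite set T ⊆ ℝ of target levels, SW(T) ≤ m + 1 + 1/m; i.e., T* is optimal, yet its two smallest targets are at distance 1/m, which tends to 0 as m → ∞ while Δ = 1. -/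
theorem imp_le_of_mem {d p t : ℝ} {T : Finset ℝ} (h : t ∈ T) (h1 : p < t) (h2 : t ≤ p + d) :
    imp d p T ≤ t - p := by
  have hm : t ∈ T.filter (fun τ => p < τ ∧ τ ≤ p + d) := by simp [h, h1, h2]
  unfold imp
  rw [dif_pos ⟨t, hm⟩]
  have := Finset.min'_le _ _ hm
  linarith

theorem imp_zero_or (d p : ℝ) (T : Finset ℝ) :
    imp d p T = 0 ∨ ∃ t ∈ T, p < t ∧ t ≤ p + d ∧ imp d p T = t - p := by
  by_cases h : (T.filter (fun τ => p < τ ∧ τ ≤ p + d)).Nonempty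
  · right
    have hm := Finset.min'_mem _ h
    have hm2 := Finset.mem_filter.1 hm
    refine ⟨_, hm2.1, hm2.2.1, hm2.2.2, ?_⟩
    unfold imp
    rw [dif_pos h]
  · left
    unfold imp
    rw [dif_neg h]

theorem imp_eq_of_least_s19 {d p t : ℝ} {T : Finset ℝ} (h : t ∈ T) (h1 : p < t) (h2 : t ≤ p + d)
    (h3 : ∀ s ∈ T, p < s → t ≤ s) : imp d p T = t - p := by
  have hm : t ∈ T.filter (fun τ => p < τ ∧ τ ≤ p + d) := by simp [h, h1, h2]
  apply le_antisymm (imp_le_of_mem h h1 h2)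
  unfold imp
  rw [dif_pos ⟨t, hm⟩]
  have h4 := Finset.mem_filter.1 (Finset.min'_mem _ ⟨t, hm⟩)
  have := h3 _ h4.1 h4.2.1
  linarith

/-- with `Δ = 1`, one agent at `0`, one agent at `1`, and `m` agents at
`1 + 1/m`, the target set `{1, 1 + 1/m, 2 + 1/m}` is optimal, with welfare
`m + 1 + 1/m`, even though its two smallest targets are at distance `1/m`. -/
theorem consecutive_targets_arbitrarily_close
    (m : ℕ) (hm : 1 ≤ m) :
    let A : Multiset ℝ := 0 ::ₘ 1 ::ₘ Multiset.replicate m (1 + 1 / (m : ℝ))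
    let Tstar : Finset ℝ := {1, 1 + 1 / (m : ℝ), 2 + 1 / (m : ℝ)}
    swM 1 A Tstar = (m : ℝ) + 1 + 1 / (m : ℝ) ∧
    ∀ T : Finset ℝ, swM 1 A T ≤ (m : ℝ) + 1 + 1 / (m : ℝ) := by
  intro A Tstar
  have hm0 : (1 : ℝ) ≤ m := by exact_mod_cast hm
  have hsw : ∀ T, swM 1 A T = imp 1 0 T + (imp 1 1 T + m * imp 1 (1 + 1 / (m : ℝ)) T) := by
    intro T
    simp [swM, A]
  have hpos : 0 < 1 / (m : ℝ) := by positivity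
  have hle : 1 / (m : ℝ) ≤ 1 := by
    rw [div_le_one (by linarith)]
    exact hm0
  have hmul : (m : ℝ) * (1 / (m : ℝ)) = 1 := by field_simp
  simp only [hsw]
  have hT : ∀ s, s ∈ Tstar ↔ s = 1 ∨ s = 1 + 1 / (m : ℝ) ∨ s = 2 + 1 / (m : ℝ) := by
    intro s
    simp only [Tstar, Finset.mem_insert, Finset.mem_singleton]
  clear_value Tstar
  generalize 1 / (m : ℝ) = e at *
  constructor
  · have a0 : imp 1 0 Tstar = 1 - 0 := by
      apply imp_eq_of_least_s19 (by simp [hT]) (by norm_num) (by norm_num)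
      intro s hs h
      rw [hT] at hs
      rcases hs with rfl | rfl | rfl <;> linarith
    have a1 : imp 1 1 Tstar = (1 + e) - 1 := by
      apply imp_eq_of_least_s19 (by simp [hT]) (by linarith) (by linarith)
      intro s hs h
      rw [hT] at hs
      rcases hs with rfl | rfl | rfl <;> linarith
    have a2 : imp 1 (1 + e) Tstar = (2 + e) - (1 + e) := by
      apply imp_eq_of_least_s19 (by simp [hT]) (by linarith) (by linarith)
      intro s hs h
      rw [hT] at hs
      rcases hs with rfl | rfl | rfl <;> linarith
    rw [a0, a1, a2]
    ring
  · intro T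
    have b0 := imp_le_one 0 T
    have b2 := imp_le_one (1 + e) T
    have b3 : (m : ℝ) * imp 1 (1 + e) T ≤ m * 1 := by gcongr
    rcases imp_zero_or 1 1 T with h | ⟨t, ht, h1, h2, h⟩
    · linarith
    · by_cases hc : t ≤ 1 + e
      · linarith
      · push Not at hc
        have b4 := imp_le_of_mem (d := 1) ht hc (by linarith)
        have b5 : (m : ℝ) * imp 1 (1 + e) T ≤ m * (1 - e) := by
          gcongr
          linarith
        have b6 : (m : ℝ) * (1 - e) = m - 1 := by rw [mul_sub, hmul, mul_one]
        linarith
end
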